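/- The set 𝒜 = {gcd(n, F_n) : n ≥ 1} satisfies #(𝒜 ∩ [1, x]) ≫ x / log x for all x ≥ 2; that is, there exists c > 0 with #(𝒜 ∩ [1,x]) ≥ c x / log x for all x ≥ 2. -/

import Mathlib

/-- Rank of appearance of `n` in the Fibonacci sequence. -/
noncomputable def zf (n : ℕ) : ℕ := sInf {k | 0 < k ∧ n ∣ Nat.fib k}

noncomputable def ellf (n : ℕ) : ℕ := Nat.lcm n (zf n)

def gf (n : ℕ) : ℕ := Nat.gcd n (Nat.fib n)

def Afib : Set ℕ := {m | ∃ n : ℕ, 0 < n ∧ gf n = m}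

lemma zsqrt_pow (n : ℕ) : (⟨1, 1⟩ : ℤ√5) ^ (n + 1) =
    ⟨2 ^ n * (2 * Nat.fib n + Nat.fib (n + 1)), 2 ^ n * Nat.fib (n + 1)⟩ := by
  induction n with
  | zero => simp
  | succ n ih =>
    rw [pow_succ, ih]
    have h := Nat.fib_add_two (n := n)
    ext
    · simp only [Zsqrtd.re_mul]
      rw [show n + 1 + 1 = n + 2 from rfl, h]; push_cast; ring
    · simp only [Zsqrtd.im_mul]
      rw [show n + 1 + 1 = n + 2 from rfl, h]; push_cast; ring

lemma sqrt_pow_odd (k : ℕ) : (⟨0, 1⟩ : ℤ√5) ^ (2 * k + 1) = ⟨0, 5 ^ k⟩ := by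
  induction k with
  | zero => simp
  | succ n ih =>
    rw [show 2 * (n + 1) + 1 = (2 * n + 1) + 2 by ring, pow_add, ih, pow_two]
    ext <;> simp [Zsqrtd.re_mul, Zsqrtd.im_mul, pow_succ]

lemma cassini (n : ℕ) : (Nat.fib n : ℤ) * Nat.fib (n + 2) - (Nat.fib (n + 1) : ℤ) ^ 2
    = (-1) ^ (n + 1) := by
  induction n with
  | zero => simp
  | succ n ih =>
    have h1 := Nat.fib_add_two (n := n)
    have h2 := Nat.fib_add_two (n := n + 1)
    rw [show n + 1 + 1 = n + 2 from rfl] at *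
    rw [pow_succ (-1 : ℤ) (n + 1), ← ih, h2, h1]
    push_cast
    ring

lemma fib_prime_sq (p : ℕ) (hp : p.Prime) (h2 : p ≠ 2) (h5 : p ≠ 5) :
    (p : ℤ) ∣ (Nat.fib p : ℤ) ^ 2 - 1 := by
  obtain ⟨k, hk⟩ := hp.odd_of_ne_two h2
  obtain ⟨r, hr⟩ := exists_add_pow_prime_eq hp (1 : ℤ√5) ⟨0, 1⟩
  have e : (1 : ℤ√5) + ⟨0, 1⟩ = ⟨1, 1⟩ := by ext <;> simp
  rw [e, one_pow] at hr
  have h3 := zsqrt_pow (2 * k)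
  rw [← hk, hr] at h3
  have h4 := sqrt_pow_odd k
  rw [← hk] at h4
  rw [h4] at h3
  have h6 := congrArg Zsqrtd.im h3
  simp only [Zsqrtd.im_add, Zsqrtd.im_one, zero_add, mul_assoc, Zsqrtd.im_mul (p : ℤ√5),
    Zsqrtd.re_natCast, Zsqrtd.im_natCast, mul_zero, zero_mul, add_zero] at h6
  have : Fact p.Prime := ⟨hp⟩
  have c2 : (2 : ZMod p) ^ (2 * k) = 1 := by
    have := ZMod.pow_card_sub_one_eq_one (p := p) (a := 2) (by
      intro h
      have : ((2 : ℕ) : ZMod p) = 0 := by exact_mod_cast h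
      rw [ZMod.natCast_eq_zero_iff] at this
      exact h2 ((Nat.prime_dvd_prime_iff_eq hp Nat.prime_two).1 this))
    rwa [show p - 1 = 2 * k by omega] at this
  have c5 : (5 : ZMod p) ^ (2 * k) = 1 := by
    have := ZMod.pow_card_sub_one_eq_one (p := p) (a := 5) (by
      intro h
      have : ((5 : ℕ) : ZMod p) = 0 := by exact_mod_cast h
      rw [ZMod.natCast_eq_zero_iff] at this
      exact h5 ((Nat.prime_dvd_prime_iff_eq hp Nat.prime_five).1 this))
    rwa [show p - 1 = 2 * k by omega] at this
  have h7 := congrArg (Int.cast : ℤ → ZMod p) h6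
  push_cast at h7
  rw [c2] at h7
  simp only [CharP.cast_eq_zero, zero_mul, add_zero, one_mul] at h7
  rw [← ZMod.intCast_zmod_eq_zero_iff_dvd _ p |>.symm.symm]
  push_cast
  rw [← h7, ← pow_mul, mul_comm k 2, c5, sub_self]

lemma fib_prime (p : ℕ) (hp : p.Prime) (h5 : p ≠ 5) :
    p ∣ Nat.fib (p - 1) ∨ p ∣ Nat.fib (p + 1) := by
  by_cases h2 : p = 2
  · subst h2; right; decide
  have h := fib_prime_sq p hp h2 h5
  have hc := cassini (p - 1)
  have h1 := hp.one_lt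
  rw [show p - 1 + 2 = p + 1 by omega, show p - 1 + 1 = p by omega,
    (hp.odd_of_ne_two h2).neg_one_pow] at hc
  have : (p : ℤ) ∣ (Nat.fib (p - 1) : ℤ) * Nat.fib (p + 1) := by
    convert h using 1; linarith
  have : p ∣ Nat.fib (p - 1) * Nat.fib (p + 1) := by exact_mod_cast this
  exact hp.dvd_mul.1 this

lemma zf_spec (q w : ℕ) (hw : 0 < w) (h : q ∣ Nat.fib w) : 0 < zf q ∧ q ∣ Nat.fib (zf q) :=
  Nat.sInf_mem (s := {k | 0 < k ∧ q ∣ Nat.fib k}) ⟨w, hw, h⟩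

lemma zf_dvd (q w : ℕ) (hw : 0 < w) (h : q ∣ Nat.fib w) : zf q ∣ w := by
  obtain ⟨h1, h2⟩ := zf_spec q w hw h
  have h3 : q ∣ Nat.fib (Nat.gcd (zf q) w) := by
    rw [Nat.fib_gcd]; exact Nat.dvd_gcd h2 h
  have h4 : zf q ≤ Nat.gcd (zf q) w := Nat.sInf_le ⟨Nat.gcd_pos_of_pos_left _ h1, h3⟩
  have h5 : Nat.gcd (zf q) w = zf q := le_antisymm (Nat.gcd_le_left _ h1) h4
  exact Nat.gcd_eq_left_iff_dvd.1 h5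

lemma zf_prime (q : ℕ) (hq : q.Prime) (h5 : q ≠ 5) :
    0 < zf q ∧ q ∣ Nat.fib (zf q) ∧ (zf q ∣ q - 1 ∨ zf q ∣ q + 1) := by
  have h1 := hq.one_lt
  rcases fib_prime q hq h5 with h | h
  · have := zf_spec q (q - 1) (by omega) h
    exact ⟨this.1, this.2, Or.inl (zf_dvd q _ (by omega) h)⟩
  · have := zf_spec q (q + 1) (by omega) h
    exact ⟨this.1, this.2, Or.inr (zf_dvd q _ (by omega) h)⟩

/-- the key structure of the elements produced from a prime -/
lemma element (p : ℕ) (hp : p.Prime) (h5 : 5 < p) :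
    ∃ w h : ℕ, (w = p - 1 ∨ w = p + 1) ∧ 0 < h ∧ h ∣ w ∧ p * h ∈ Afib ∧
      ∀ q : ℕ, q.Prime → q ≠ 5 → q ∣ h → q * zf q ∣ w := by
  obtain ⟨w, hw, hpw⟩ : ∃ w, (w = p - 1 ∨ w = p + 1) ∧ p ∣ Nat.fib w := by
    rcases fib_prime p hp (by omega) with h | h
    · exact ⟨_, Or.inl rfl, h⟩
    · exact ⟨_, Or.inr rfl, h⟩
  have hw0 : 0 < w := by omega
  have hn0 : 0 < p * w := Nat.mul_pos hp.pos hw0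
  have hd : p ∣ gf (p * w) :=
    Nat.dvd_gcd (dvd_mul_right _ _) (hpw.trans (Nat.fib_dvd _ _ (dvd_mul_left _ _)))
  obtain ⟨h, hh⟩ := hd
  have hgpos : 0 < gf (p * w) := Nat.gcd_pos_of_pos_left _ hn0
  have hhw : h ∣ w := by
    have : p * h ∣ p * w := hh ▸ Nat.gcd_dvd_left _ _
    exact Nat.dvd_of_mul_dvd_mul_left hp.pos this
  refine ⟨w, h, hw, ?_, hhw, ⟨p * w, hn0, hh⟩, ?_⟩
  · rcases Nat.eq_zero_or_pos h with h0 | h0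
    · subst h0; omega
    · exact h0
  · intro q hq hq5 hqh
    have hqw : q ∣ w := hqh.trans hhw
    have hqF : q ∣ Nat.fib (p * w) := by
      have : p * h ∣ Nat.fib (p * w) := hh ▸ Nat.gcd_dvd_right _ _
      exact (hqh.trans (dvd_mul_left _ _)).trans this
    have hz := zf_dvd q _ hn0 hqF
    obtain ⟨z0, -, z1⟩ := zf_prime q hq hq5
    have hq1 := hq.one_lt
    have hzle : zf q ≤ q + 1 := by
      rcases z1 with z1 | z1
      · have := Nat.le_of_dvd (by omega) z1; omega
      · exact Nat.le_of_dvd (by omega) z1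
    have hodd := hp.odd_of_ne_two (by omega)
    have hweven : 2 ∣ w := by
      obtain ⟨k, hk⟩ := hodd
      rcases hw with hw | hw <;> omega
    have hqlt : 2 * q ≤ w := by
      obtain ⟨t, ht⟩ := hqw
      have : t ≠ 0 := by rintro rfl; omega
      have : t ≠ 1 := by
        rintro rfl
        rw [mul_one] at ht
        have := (Nat.prime_dvd_prime_iff_eq Nat.prime_two hq).1 (ht ▸ hweven)
        omega
      have : 2 ≤ t := by omega
      rw [ht, mul_comm]; exact Nat.mul_le_mul_left _ this
    have hcop : Nat.Coprime (zf q) p := by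
      rw [Nat.coprime_comm, hp.coprime_iff_not_dvd]
      intro hdvd
      have := Nat.le_of_dvd z0 hdvd
      omega
    have hzw : zf q ∣ w := hcop.dvd_of_dvd_mul_left hz
    have hcop2 : Nat.Coprime q (zf q) := by
      rw [hq.coprime_iff_not_dvd]
      intro hdvd
      rcases z1 with z1 | z1
      · have := Nat.le_of_dvd (by omega) (hdvd.trans z1); omega
      · have := (Nat.dvd_add_right (dvd_refl q)).1 (hdvd.trans z1)
        have := Nat.le_of_dvd (by omega) this; omega
    exact hcop2.mul_dvd_of_dvd_of_dvd hqw hzw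

lemma factorial_dvd_prod (N d b : ℕ) :
    N.factorial ∣ (∏ i ∈ Finset.range N, (d * i + b)) * d ^ N := by
  rw [Nat.dvd_iff_prime_pow_dvd_dvd]
  intro r k hr hk
  by_cases hrd : r ∣ d
  · apply Dvd.dvd.mul_left
    have : Fact r.Prime := ⟨hr⟩
    have hkN : k ≤ N := by
      have h1 : k ≤ padicValNat r N.factorial :=
        (padicValNat_dvd_iff_le (Nat.factorial_ne_zero N)).1 hk
      have h2 := sub_one_mul_padicValNat_factorial (p := r) N
      have h3 := hr.two_le
      have h4 : 1 * padicValNat r N.factorial ≤ (r - 1) * padicValNat r N.factorial :=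
        Nat.mul_le_mul_right _ (by omega)
      omega
    exact (pow_dvd_pow r hkN).trans (pow_dvd_pow_of_dvd hrd N)
  · apply Dvd.dvd.mul_right
    have hcop : Nat.Coprime d (r ^ k) :=
      (Nat.Coprime.pow_left k ((Nat.Prime.coprime_iff_not_dvd hr).2 hrd)).symm
    let u : (ZMod (r ^ k))ˣ := ZMod.unitOfCoprime d hcop
    have hu : (u : ZMod (r ^ k)) = (d : ZMod (r ^ k)) := ZMod.coe_unitOfCoprime d hcop
    have : NeZero (r ^ k) := ⟨pow_ne_zero _ hr.ne_zero⟩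
    obtain ⟨e, he⟩ : ∃ e : ℕ, (e : ZMod (r ^ k)) = ((u⁻¹ : (ZMod (r ^ k))ˣ) : ZMod (r ^ k)) :=
      ⟨_, ZMod.natCast_zmod_val _⟩
    have h1 : r ^ k ∣ (e * b).ascFactorial N :=
      hk.trans (Nat.factorial_dvd_ascFactorial _ _)
    rw [Nat.ascFactorial_eq_prod_range, ← ZMod.natCast_eq_zero_iff] at h1
    rw [← ZMod.natCast_eq_zero_iff]
    push_cast at h1 ⊢
    have h2 : ∏ i ∈ Finset.range N, ((d : ZMod (r ^ k)) * i + b)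
        = ∏ i ∈ Finset.range N, ((d : ZMod (r ^ k)) * ((e : ZMod (r ^ k)) * b + i)) := by
      apply Finset.prod_congr rfl
      intro i _
      have : (d : ZMod (r ^ k)) * e = 1 := by rw [← hu, he, Units.mul_inv]
      linear_combination (-(b : ZMod (r ^ k))) * this
    rw [h2, Finset.prod_mul_distrib, h1, mul_zero]

/-- weak Brun-Titchmarsh -/
lemma weak_bt (X d b : ℕ) (hd : 16 ≤ d) (hX : 64 ≤ X) (hdX : d ≤ X + 1) (hb0 : 0 < b) (hb : b ≤ d + 1)
    (T : Finset ℕ) (hT : ∀ p ∈ T, p.Prime ∧ X < 8 * p ∧ p ≤ X ∧ ∃ i, p = d * i + b) :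
    (T.card : ℝ) * Real.log X ≤ 18 * X * (Real.log d / d) := by
  set N := X / d + 1 with hN
  set P := ∏ i ∈ Finset.range N, (d * i + b) with hP
  have hNle : N ≤ X / 16 + 1 := by
    have := Nat.div_le_div_left (a := X) hd (by norm_num)
    omega
  have hdvdP : (∏ p ∈ T, p) ∣ P := by
    apply Finset.prod_primes_dvd
    · intro p hp; exact (hT p hp).1.prime
    · intro p hp
      obtain ⟨_, _, hpX, i, hi⟩ := hT p hp
      have : i < N := by
        have : i ≤ X / d := by
          rw [Nat.le_div_iff_mul_le (by omega)]
          rw [mul_comm]; omega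
        omega
      rw [hi]
      exact Finset.dvd_prod_of_mem (fun i => d * i + b) (Finset.mem_range.2 this)
  have hcop : Nat.Coprime (∏ p ∈ T, p) N.factorial := by
    apply Nat.Coprime.prod_left
    intro p hp
    obtain ⟨hpp, h8, _⟩ := hT p hp
    rw [Nat.coprime_factorial_iff hpp.one_lt.ne', hpp.minFac_eq]
    omega
  have hdvd : (∏ p ∈ T, p) * N.factorial ∣ P * d ^ N :=
    hcop.mul_dvd_of_dvd_of_dvd (hdvdP.mul_right _) (factorial_dvd_prod N d b)
  have hPpos : 0 < P * d ^ N := by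
    apply Nat.mul_pos
    · exact Finset.prod_pos fun i _ => by omega
    · exact pow_pos (by omega) _
  have hle := Nat.le_of_dvd hPpos hdvd
  have hPle : P ≤ (2 * d * N) ^ N := by
    calc P ≤ ∏ i ∈ Finset.range N, (2 * d * N) := by
          apply Finset.prod_le_prod' 
          intro i hi
          have hi := Finset.mem_range.1 hi
          have : d * (i + 1) ≤ d * N := Nat.mul_le_mul_left _ hi
          have h2 : d * 1 ≤ d * N := Nat.mul_le_mul_left _ (by omega)
          rw [mul_add] at this
          rw [mul_assoc]
          omega
      _ = _ := by simp
  have hlow : ((X : ℝ) / 8) ^ T.card ≤ ((∏ p ∈ T, p : ℕ) : ℝ) := by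
    push_cast
    rw [← Finset.prod_const]
    apply Finset.prod_le_prod
    · intro i _; positivity
    · intro p hp
      have : (X : ℝ) < 8 * p := by exact_mod_cast (hT p hp).2.1
      linarith
  have hle2 : ((∏ p ∈ T, p : ℕ) : ℝ) * N.factorial ≤ (2 * d * N) ^ N * d ^ N := by
    have : (∏ p ∈ T, p) * N.factorial ≤ (2 * d * N) ^ N * d ^ N :=
      hle.trans (Nat.mul_le_mul_right _ hPle)
    exact_mod_cast this
  have hfac : (0 : ℝ) < N.factorial := by exact_mod_cast N.factorial_pos
  have hexp : (N : ℝ) ^ N ≤ Real.exp N * N.factorial := by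
    have := Real.pow_div_factorial_le_exp (N : ℝ) (by positivity) N
    rwa [div_le_iff₀ hfac] at this
  have hd0 : (0 : ℝ) < d := by
    have : 0 < d := by omega
    exact_mod_cast this
  have hX0 : (64 : ℝ) ≤ X := by exact_mod_cast hX
  have hmain : ((X : ℝ) / 8) ^ T.card ≤ (2 * d ^ 2) ^ N * Real.exp N := by
    have h1 : ((X : ℝ) / 8) ^ T.card * N.factorial
        ≤ ((2 * d ^ 2) ^ N * Real.exp N) * N.factorial := by
      calc ((X : ℝ) / 8) ^ T.card * N.factorial
          ≤ ((∏ p ∈ T, p : ℕ) : ℝ) * N.factorial := by gcongr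
        _ ≤ (2 * d * N) ^ N * d ^ N := hle2
        _ = (2 * (d : ℝ) ^ 2) ^ N * (N : ℝ) ^ N := by
            rw [← mul_pow, ← mul_pow]; congr 1; ring
        _ ≤ (2 * (d : ℝ) ^ 2) ^ N * (Real.exp N * N.factorial) := by gcongr
        _ = _ := by ring
    exact le_of_mul_le_mul_right h1 hfac
  have hlog := Real.log_le_log (by positivity) hmain
  rw [Real.log_mul (by positivity) (Real.exp_ne_zero _), Real.log_exp, Real.log_pow,
    Real.log_pow, Real.log_mul (by norm_num) (by positivity), Real.log_pow] at hlog
  have hl2 : Real.log 2 + 1 ≤ Real.log d := by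
    have h16 : Real.log 16 ≤ Real.log d := Real.log_le_log (by norm_num) (by exact_mod_cast hd)
    have : Real.log 16 = 4 * Real.log 2 := by
      rw [show (16 : ℝ) = 2 ^ 4 by norm_num, Real.log_pow]; norm_num
    have := Real.log_two_gt_d9
    linarith
  have hlX : Real.log X ≤ 2 * Real.log (X / 8) := by
    rw [show 2 * Real.log ((X : ℝ) / 8) = Real.log ((X / 8) ^ 2) by rw [Real.log_pow]; norm_num]
    apply Real.log_le_log (by linarith)
    nlinarith
  have hNr : (N : ℝ) ≤ 3 * X / d := by
    rw [le_div_iff₀ hd0]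
    have h1 : N * d ≤ 3 * X := by
      have := Nat.div_mul_le_self X d
      rw [hN, add_mul]; omega
    exact_mod_cast h1
  have hld : 0 ≤ Real.log d := by have := Real.log_two_gt_d9; linarith
  have hTc : (0 : ℝ) ≤ T.card := by positivity
  have hN0 : (0 : ℝ) ≤ N := by positivity
  calc (T.card : ℝ) * Real.log X ≤ T.card * (2 * Real.log (X / 8)) := by gcongr
    _ = 2 * (T.card * Real.log (X / 8)) := by ring
    _ ≤ 2 * (N * (3 * Real.log d)) := by
        push_cast at hlog
        have : (N : ℝ) * (Real.log 2 + 1) ≤ N * Real.log d := by gcongr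
        nlinarith
    _ ≤ 2 * ((3 * X / d) * (3 * Real.log d)) := by gcongr
    _ = _ := by ring

/-- primes in the window (X/8, X] -/
def win (X : ℕ) : Finset ℕ := (Finset.range (X + 1)).filter (fun p => p.Prime ∧ X < 8 * p)

lemma bt_both (X d : ℕ) (hd : 16 ≤ d) (hX : 64 ≤ X) :
    (((win X).filter (fun p => d ∣ p - 1 ∨ d ∣ p + 1)).card : ℝ) * Real.log X
      ≤ 36 * X * (Real.log d / d) := by
  have hX1 : (1 : ℝ) ≤ X := by exact_mod_cast (by omega : 1 ≤ X)
  have hnn : (0 : ℝ) ≤ Real.log X := Real.log_nonneg hX1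
  have hp0 : ∀ p ∈ win X, p.Prime ∧ X < 8 * p ∧ p ≤ X := by
    intro p hp
    simp only [win, Finset.mem_filter, Finset.mem_range] at hp
    exact ⟨hp.2.1, hp.2.2, by omega⟩
  by_cases hdX : d ≤ X + 1
  · have h1 := weak_bt X d (d + 1) hd hX hdX (by omega) le_rfl
      ((win X).filter (fun p => d ∣ p - 1)) (by
        intro p hp
        rw [Finset.mem_filter] at hp
        obtain ⟨a, b, c⟩ := hp0 p hp.1
        refine ⟨a, b, c, ?_⟩
        obtain ⟨j, hj⟩ := hp.2
        have : j ≠ 0 := by rintro rfl; omega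
        obtain ⟨i, rfl⟩ := Nat.exists_eq_succ_of_ne_zero this
        refine ⟨i, ?_⟩
        rw [Nat.succ_eq_add_one, mul_add] at hj
        omega)
    have h2 := weak_bt X d (d - 1) hd hX hdX (by omega) (by omega)
      ((win X).filter (fun p => d ∣ p + 1)) (by
        intro p hp
        rw [Finset.mem_filter] at hp
        obtain ⟨a, b, c⟩ := hp0 p hp.1
        refine ⟨a, b, c, ?_⟩
        obtain ⟨j, hj⟩ := hp.2
        have : j ≠ 0 := by rintro rfl; omega
        obtain ⟨i, rfl⟩ := Nat.exists_eq_succ_of_ne_zero this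
        refine ⟨i, ?_⟩
        rw [Nat.succ_eq_add_one, mul_add] at hj
        omega)
    have h3 : (((win X).filter (fun p => d ∣ p - 1 ∨ d ∣ p + 1)).card : ℝ) ≤
        ((win X).filter (fun p => d ∣ p - 1)).card + ((win X).filter (fun p => d ∣ p + 1)).card := by
      rw [Finset.filter_or]
      exact_mod_cast Finset.card_union_le _ _
    nlinarith
  · have : (win X).filter (fun p => d ∣ p - 1 ∨ d ∣ p + 1) = ∅ := by
      rw [Finset.filter_eq_empty_iff]
      intro p hp h
      obtain ⟨a, b, c⟩ := hp0 p hp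
      rcases h with h | h
      · have := Nat.le_of_dvd (by omega) h; omega
      · have := Nat.le_of_dvd (by omega) h; omega
    rw [this]
    have hd1 : (1 : ℝ) ≤ d := by exact_mod_cast (by omega : 1 ≤ d)
    have := Real.log_nonneg hd1
    simp only [Finset.card_empty, Nat.cast_zero, zero_mul]
    positivity

open Filter in
lemma win_lower : ∃ X0 : ℕ, ∀ X : ℕ, X0 ≤ X → (X : ℝ) / 3 ≤ (win X).card * Real.log X := by
  have l1 : (fun x : ℝ => Real.log x) =o[atTop] (fun x => x ^ (1 / 4 : ℝ)) :=
    isLittleO_log_rpow_atTop (by norm_num)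
  have l2 := (l1.bound (show (0 : ℝ) < 1 by norm_num))
  have l3 : Tendsto (fun x : ℝ => x ^ (1 / 4 : ℝ)) atTop atTop := tendsto_rpow_atTop (by norm_num)
  have key : ∀ᶠ x : ℝ in atTop, Real.log (x + 1) + 2 * √x * Real.log x ≤ x / 100 := by
    filter_upwards [l2, l3.eventually_ge_atTop 1000, eventually_ge_atTop 4] with x h1 h2 h3
    have hx0 : 0 < x := by linarith
    set y := x ^ (1 / 4 : ℝ) with hy
    have hy4 : x = y ^ 4 := by
      rw [hy, ← Real.rpow_natCast, ← Real.rpow_mul hx0.le]; norm_num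
    have hlx : 0 ≤ Real.log x := Real.log_nonneg (by linarith)
    rw [Real.norm_of_nonneg hlx, Real.norm_of_nonneg (by linarith), one_mul] at h1
    have hs : √x = y ^ 2 := by
      rw [hy4, show y ^ 4 = (y ^ 2) ^ 2 by ring, Real.sqrt_sq (by positivity)]
    have h4 : Real.log (x + 1) ≤ 2 * Real.log x := by
      rw [show 2 * Real.log x = Real.log (x ^ 2) by rw [Real.log_pow]; norm_num]
      apply Real.log_le_log (by linarith)
      nlinarith
    rw [hs]
    have h5 : 2 * y ^ 2 * Real.log x ≤ 2 * y ^ 2 * y := by gcongr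
    have h6 : Real.log (x + 1) ≤ 2 * y := by linarith
    have h7 : 1000 * y ^ 3 ≤ x := by
      rw [hy4]; nlinarith [pow_pos (by linarith : 0 < y) 3]
    nlinarith [sq_nonneg y]
  obtain ⟨x0, hx0⟩ := eventually_atTop.1 key
  refine ⟨max ⌈x0⌉₊ 2, fun X hX => ?_⟩
  have hXx : x0 ≤ X := Nat.ceil_le.1 ((le_max_left _ _).trans hX)
  have hX2 : 2 ≤ X := (le_max_right _ _).trans hX
  have h1 := hx0 X hXx
  have h2 := Chebyshev.theta_ge X
  have h3 := Chebyshev.theta_le_log4_mul_x (x := (X : ℝ) / 8) (by positivity)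
  have h4 : Chebyshev.theta X ≤ Chebyshev.theta ((X : ℝ) / 8) + (win X).card * Real.log X := by
    rw [← nsmul_eq_mul, ← Finset.sum_const, Chebyshev.theta, Chebyshev.theta]
    have hlogs : ∑ p ∈ win X, Real.log p ≤ ∑ p ∈ win X, Real.log X := by
      apply Finset.sum_le_sum
      intro p hp
      simp only [win, Finset.mem_filter, Finset.mem_range] at hp
      apply Real.log_le_log
      · exact_mod_cast hp.2.1.pos
      · exact_mod_cast (by omega : p ≤ X)
    refine le_trans ?_ (add_le_add_right hlogs _)
    rw [← Finset.sum_union_inter]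
    refine le_trans ?_ (le_add_of_nonneg_right (Finset.sum_nonneg fun p _ => Real.log_natCast_nonneg p))
    apply Finset.sum_le_sum_of_subset_of_nonneg
    · intro p hp
      simp only [Finset.mem_filter, Finset.mem_Ioc, Nat.floor_natCast, Finset.mem_union, win,
        Finset.mem_range] at hp ⊢
      by_cases h8 : X < 8 * p
      · right; exact ⟨by omega, hp.2, h8⟩
      · left
        refine ⟨⟨hp.1.1, ?_⟩, hp.2⟩
        apply Nat.le_floor
        have : (8 * p : ℝ) ≤ X := by exact_mod_cast (not_lt.1 h8)
        linarith
    · intro p _ _; exact Real.log_natCast_nonneg p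
  have h5 : Real.log 4 = 2 * Real.log 2 := by
    rw [show (4 : ℝ) = 2 ^ 2 by norm_num, Real.log_pow]; norm_num
  have h6 := Real.log_two_gt_d9
  have hX0 : (0 : ℝ) ≤ X := by positivity
  rw [h5] at h3
  nlinarith

lemma log_div_le (d : ℝ) (hd : 0 < d) : Real.log d / d ≤ 10 * d ^ (-(9 / 10) : ℝ) := by
  have h := Real.log_le_rpow_div hd.le (show (0 : ℝ) < 1 / 10 by norm_num)
  rw [div_le_iff₀ hd, mul_assoc, ← Real.rpow_add_one hd.ne']
  norm_num at h ⊢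
  linarith

lemma fib_le_two_pow (k : ℕ) : Nat.fib k ≤ 2 ^ k ∧ Nat.fib (k + 1) ≤ 2 ^ (k + 1) := by
  induction k with
  | zero => simp
  | succ n ih =>
    refine ⟨ih.2, ?_⟩
    rw [show n + 1 + 1 = n + 2 from rfl, Nat.fib_add_two, pow_add]
    have := ih.1; have := ih.2
    rw [pow_succ] at this
    omega

lemma card_primeFactors_fib (k : ℕ) (hk : 0 < k) : (Nat.fib k).primeFactors.card ≤ k := by
  have h1 : 2 ^ (Nat.fib k).primeFactors.card ≤ ∏ p ∈ (Nat.fib k).primeFactors, p :=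
    Finset.pow_card_le_prod _ _ _ fun p hp => (Nat.prime_of_mem_primeFactors hp).two_le
  have h2 := Nat.le_of_dvd (Nat.fib_pos.2 hk) (Nat.prod_primeFactors_dvd (Nat.fib k))
  exact (Nat.pow_le_pow_iff_right (by norm_num)).1 (h1.trans (h2.trans (fib_le_two_pow k).1))

open Classical in
noncomputable def gz (q : ℕ) : ℝ :=
  if q.Prime ∧ q ≠ 5 then 10 * (zf q : ℝ) ^ (-(18 / 5) : ℝ) else 0

open Classical in
noncomputable def f2 (q : ℕ) : ℝ :=
  if q.Prime ∧ q ≠ 5 then Real.log ((q * zf q : ℕ) : ℝ) / ((q * zf q : ℕ) : ℝ) else 0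

noncomputable def f1 (s : ℕ) : ℝ := Real.log ((s ^ 2 : ℕ) : ℝ) / ((s ^ 2 : ℕ) : ℝ)

lemma f1_nonneg (s : ℕ) : 0 ≤ f1 s := by
  unfold f1
  exact div_nonneg (Real.log_natCast_nonneg _) (by positivity)

lemma f2_nonneg (s : ℕ) : 0 ≤ f2 s := by
  unfold f2
  split_ifs
  · exact div_nonneg (Real.log_natCast_nonneg _) (by positivity)
  · exact le_rfl

lemma summable_f1 : Summable f1 := by
  have h : Summable (fun n : ℕ => 10 * (n : ℝ) ^ (-(9 / 5) : ℝ)) :=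
    (Real.summable_nat_rpow.2 (by norm_num)).mul_left 10
  refine Summable.of_nonneg_of_le f1_nonneg (fun s => ?_) h
  rcases Nat.eq_zero_or_pos s with rfl | hs
  · simp [f1]
  · have hs' : (0 : ℝ) < s := by exact_mod_cast hs
    unfold f1
    push_cast
    refine (log_div_le _ (by positivity)).trans (le_of_eq ?_)
    rw [← Real.rpow_natCast, ← Real.rpow_mul hs'.le]
    norm_num

lemma summable_gz : Summable gz := by
  classical
  have h : Summable (fun n : ℕ => 10 * (n : ℝ) ^ (-(13 / 5) : ℝ)) :=
    (Real.summable_nat_rpow.2 (by norm_num)).mul_left 10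
  refine summable_of_sum_le (c := ∑' n : ℕ, 10 * (n : ℝ) ^ (-(13 / 5) : ℝ)) ?_ ?_
  · intro q; unfold gz; split_ifs
    · positivity
    · exact le_rfl
  · intro u
    simp only [gz]
    rw [← Finset.sum_filter]
    set u' := u.filter (fun q => q.Prime ∧ q ≠ 5) with hu'
    rw [← Finset.sum_fiberwise_of_maps_to (s := u') (t := u'.image zf) (g := zf)
      (fun q hq => Finset.mem_image_of_mem _ hq)]
    refine le_trans (Finset.sum_le_sum ?_)
      (h.sum_le_tsum (u'.image zf) (fun i _ => by positivity))
    intro k hk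
    obtain ⟨q0, hq0, hq0k⟩ := Finset.mem_image.1 hk
    have hk0 : 0 < k := by
      rw [Finset.mem_filter] at hq0
      rw [← hq0k]; exact (zf_prime q0 hq0.2.1 hq0.2.2).1
    have hk' : (0 : ℝ) < k := by exact_mod_cast hk0
    have hsub : u'.filter (fun q => zf q = k) ⊆ (Nat.fib k).primeFactors := by
      intro q hq
      simp only [hu', Finset.mem_filter] at hq
      rw [Nat.mem_primeFactors]
      refine ⟨hq.1.2.1, ?_, (Nat.fib_pos.2 hk0).ne'⟩
      rw [← hq.2]
      exact (zf_prime q hq.1.2.1 hq.1.2.2).2.1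
    have hcard : ((u'.filter (fun q => zf q = k)).card : ℝ) ≤ k := by
      exact_mod_cast (Finset.card_le_card hsub).trans (card_primeFactors_fib k hk0)
    calc ∑ q ∈ u'.filter (fun q => zf q = k), 10 * (zf q : ℝ) ^ (-(18 / 5) : ℝ)
        = ∑ q ∈ u'.filter (fun q => zf q = k), 10 * (k : ℝ) ^ (-(18 / 5) : ℝ) := by
          apply Finset.sum_congr rfl
          intro q hq
          rw [(Finset.mem_filter.1 hq).2]
      _ = (u'.filter (fun q => zf q = k)).card * (10 * (k : ℝ) ^ (-(18 / 5) : ℝ)) := by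
          rw [Finset.sum_const, nsmul_eq_mul]
      _ ≤ k * (10 * (k : ℝ) ^ (-(18 / 5) : ℝ)) := by gcongr
      _ = 10 * ((k : ℝ) ^ (-(18 / 5) : ℝ) * k) := by ring
      _ = 10 * (k : ℝ) ^ (-(13 / 5) : ℝ) := by
          rw [← Real.rpow_add_one hk'.ne']; norm_num

lemma summable_f2 : Summable f2 := by
  have h : Summable (fun n : ℕ => 10 * (n : ℝ) ^ (-(6 / 5) : ℝ)) :=
    (Real.summable_nat_rpow.2 (by norm_num)).mul_left 10
  refine Summable.of_nonneg_of_le f2_nonneg (fun q => ?_) (h.add summable_gz)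
  by_cases hq : q.Prime ∧ q ≠ 5
  · simp only [f2, gz, if_pos hq]
    have hq0 : (0 : ℝ) < q := by exact_mod_cast hq.1.pos
    have hz0 : (0 : ℝ) < zf q := by exact_mod_cast (zf_prime q hq.1 hq.2).1
    push_cast
    set z : ℝ := ((zf q : ℕ) : ℝ)
    refine (log_div_le _ (by positivity)).trans ?_
    by_cases hc : (q : ℝ) ≤ z ^ 3
    · have h1 : (q : ℝ) ^ (4 / 3 : ℝ) ≤ q * z := by
        have : (q : ℝ) ^ (1 / 3 : ℝ) ≤ z := by
          calc (q : ℝ) ^ (1 / 3 : ℝ) ≤ (z ^ 3) ^ (1 / 3 : ℝ) := by gcongr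
            _ = z := by
              rw [← Real.rpow_natCast, ← Real.rpow_mul hz0.le]; norm_num
        calc (q : ℝ) ^ (4 / 3 : ℝ) = (q : ℝ) ^ (1 / 3 : ℝ) * q := by
              rw [← Real.rpow_add_one hq0.ne']; norm_num
          _ ≤ z * q := by gcongr
          _ = _ := mul_comm _ _
      have h2 := Real.rpow_le_rpow_of_nonpos (by positivity) h1
        (show (-(9 / 10) : ℝ) ≤ 0 by norm_num)
      rw [← Real.rpow_mul hq0.le] at h2
      norm_num at h2 ⊢
      have : (0 : ℝ) ≤ z ^ (-(18 / 5) : ℝ) := by positivity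
      linarith
    · have h1 : z ^ 4 ≤ q * z := by nlinarith
      have h2 := Real.rpow_le_rpow_of_nonpos (by positivity) h1
        (show (-(9 / 10) : ℝ) ≤ 0 by norm_num)
      rw [← Real.rpow_natCast, ← Real.rpow_mul hz0.le] at h2
      norm_num at h2 ⊢
      have : (0 : ℝ) ≤ (q : ℝ) ^ (-(6 / 5) : ℝ) := by positivity
      linarith
  · simp only [f2, gz, if_neg hq]
    positivity

lemma exists_M : ∃ M : ℕ, 16 ≤ M ∧ ∀ t : Finset ℕ, (∀ m ∈ t, M < m) →
    ∑ m ∈ t, (f1 m + f2 m) ≤ 1 / 360 := by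
  have hs := summable_f1.add summable_f2
  obtain ⟨s, hs⟩ := summable_iff_vanishing_norm.1 hs (1 / 360) (by norm_num)
  refine ⟨max 16 (s.sup id), le_max_left _ _, fun t ht => ?_⟩
  have := hs t (by
    rw [Finset.disjoint_left]
    intro m hm hms
    have h1 := ht m hm
    have h2 : m ≤ s.sup id := Finset.le_sup (f := id) hms
    have := le_max_right 16 (s.sup id)
    omega)
  exact ((Real.le_norm_self _).trans_lt this).le

lemma h_bound (M h : ℕ) (hh : 0 < h) (hq : ∀ q : ℕ, q.Prime → q ∣ h → q ≤ M)
    (hs : ∀ s : ℕ, s ^ 2 ∣ h → s ≤ M) : h ≤ M ^ 2 * M.factorial := by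
  obtain ⟨a, b, hab, hsq⟩ := Nat.sq_mul_squarefree h
  have hb : b ≤ M := hs b ⟨a, hab.symm⟩
  have ha : a ∣ M.factorial := by
    rw [← Nat.prod_primeFactors_of_squarefree hsq]
    apply Finset.prod_primes_dvd
    · intro p hp; exact (Nat.prime_of_mem_primeFactors hp).prime
    · intro p hp
      have hpp := Nat.prime_of_mem_primeFactors hp
      rw [hpp.dvd_factorial]
      exact hq p hpp ((Nat.dvd_of_mem_primeFactors hp).trans ⟨b ^ 2, by rw [← hab, mul_comm]⟩)
  have ha' := Nat.le_of_dvd M.factorial_pos ha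
  rw [← hab]
  exact Nat.mul_le_mul (Nat.pow_le_pow_left hb 2) ha'

lemma main_count : ∃ B X1 : ℕ, 0 < B ∧ ∀ X : ℕ, X1 ≤ X → ∃ G : Finset ℕ,
    (∀ n ∈ G, n ∈ Afib ∧ n ≤ B * X) ∧ (X : ℝ) / 5 ≤ G.card * Real.log X := by
  classical
  obtain ⟨M, hM, hMsum⟩ := exists_M
  obtain ⟨X0, hX0⟩ := win_lower
  set B := M ^ 2 * M.factorial with hB
  have hB0 : 0 < B := Nat.mul_pos (pow_pos (by omega) _) M.factorial_pos
  refine ⟨B, max X0 (max 64 (8 * B)), hB0, fun X hX => ?_⟩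
  have hXX0 : X0 ≤ X := (le_max_left _ _).trans hX
  have hX64 : 64 ≤ X := (le_max_left _ _).trans ((le_max_right _ _).trans hX)
  have hX8B : 8 * B ≤ X := (le_max_right _ _).trans ((le_max_right _ _).trans hX)
  let E1 : ℕ → Finset ℕ := fun m => (win X).filter (fun p => m ^ 2 ∣ p - 1 ∨ m ^ 2 ∣ p + 1)
  let E2 : ℕ → Finset ℕ := fun m =>
    if m.Prime ∧ m ≠ 5 then (win X).filter (fun p => m * zf m ∣ p - 1 ∨ m * zf m ∣ p + 1) else ∅
  let Bad : Finset ℕ := (Finset.Ioc M (X + 1)).biUnion (fun m => E1 m ∪ E2 m)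
  let Good : Finset ℕ := win X \ Bad
  have hXr : (64 : ℝ) ≤ X := by exact_mod_cast hX64
  have hlogX : 0 ≤ Real.log X := Real.log_nonneg (by linarith)
  have hE1 : ∀ m, M < m → ((E1 m).card : ℝ) * Real.log X ≤ 36 * X * f1 m := by
    intro m hm
    exact bt_both X (m ^ 2) (by nlinarith) hX64
  have hE2 : ∀ m, M < m → ((E2 m).card : ℝ) * Real.log X ≤ 36 * X * f2 m := by
    intro m hm
    simp only [E2, f2]
    split_ifs with hc
    · have := (zf_prime m hc.1 hc.2).1
      exact bt_both X (m * zf m) (by nlinarith) hX64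
    · simp
  have hBad : (Bad.card : ℝ) * Real.log X ≤ X / 10 := by
    have h1 : (Bad.card : ℝ) ≤ ∑ m ∈ Finset.Ioc M (X + 1), (((E1 m).card : ℝ) + (E2 m).card) := by
      have : Bad.card ≤ ∑ m ∈ Finset.Ioc M (X + 1), ((E1 m).card + (E2 m).card) :=
        Finset.card_biUnion_le.trans (Finset.sum_le_sum fun m _ => Finset.card_union_le _ _)
      exact_mod_cast this
    calc (Bad.card : ℝ) * Real.log X
        ≤ (∑ m ∈ Finset.Ioc M (X + 1), (((E1 m).card : ℝ) + (E2 m).card)) * Real.log X := by gcongr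
      _ = ∑ m ∈ Finset.Ioc M (X + 1), (((E1 m).card : ℝ) + (E2 m).card) * Real.log X :=
          Finset.sum_mul _ _ _
      _ ≤ ∑ m ∈ Finset.Ioc M (X + 1), 36 * X * (f1 m + f2 m) := by
          apply Finset.sum_le_sum
          intro m hm
          have hm := (Finset.mem_Ioc.1 hm).1
          have := hE1 m hm
          have := hE2 m hm
          linarith
      _ = 36 * X * ∑ m ∈ Finset.Ioc M (X + 1), (f1 m + f2 m) := by rw [Finset.mul_sum]
      _ ≤ 36 * X * (1 / 360) := by
          gcongr
          exact hMsum _ fun m hm => (Finset.mem_Ioc.1 hm).1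
      _ = X / 10 := by ring
  have hGood : (X : ℝ) / 5 ≤ Good.card * Real.log X := by
    have h1 : ((win X).card : ℝ) ≤ Good.card + Bad.card := by
      have : (win X).card ≤ Good.card + Bad.card := by
        have := Finset.le_card_sdiff Bad (win X)
        simp only [Good]; omega
      exact_mod_cast this
    have h2 := hX0 X hXX0
    nlinarith
  have hwin : ∀ p ∈ Good, p.Prime ∧ X < 8 * p ∧ p ≤ X := by
    intro p hp
    have hp := (Finset.mem_sdiff.1 hp).1
    simp only [win, Finset.mem_filter, Finset.mem_range] at hp
    exact ⟨hp.2.1, hp.2.2, by omega⟩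
  have hel : ∀ p ∈ Good, ∃ h : ℕ, 0 < h ∧ h ≤ B ∧ p * h ∈ Afib := by
    intro p hp
    obtain ⟨hpp, hp8, hpX⟩ := hwin p hp
    obtain ⟨hpw, hnb⟩ := Finset.mem_sdiff.1 hp
    obtain ⟨w, h, hw, h0, hhw, hA, hqz⟩ := element p hpp (by omega)
    refine ⟨h, h0, h_bound M h h0 ?_ ?_, hA⟩
    · intro q hq hqh
      by_contra hlt
      apply hnb
      have hq5 : q ≠ 5 := by omega
      have hd := hqz q hq hq5 hqh
      have hqw := Nat.le_of_dvd (by omega) (hqh.trans hhw)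
      simp only [Bad, Finset.mem_biUnion, Finset.mem_Ioc, Finset.mem_union]
      refine ⟨q, ⟨by omega, by omega⟩, Or.inr ?_⟩
      simp only [E2, if_pos (And.intro hq hq5), Finset.mem_filter]
      refine ⟨hpw, ?_⟩
      rcases hw with rfl | rfl
      · exact Or.inl hd
      · exact Or.inr hd
    · intro s hsh
      by_contra hlt
      apply hnb
      have hd := hsh.trans hhw
      have hsw := Nat.le_of_dvd (by omega) hd
      have : s ≤ s ^ 2 := Nat.le_self_pow (by norm_num) s
      simp only [Bad, Finset.mem_biUnion, Finset.mem_Ioc, Finset.mem_union]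
      refine ⟨s, ⟨by omega, by omega⟩, Or.inl ?_⟩
      simp only [E1, Finset.mem_filter]
      refine ⟨hpw, ?_⟩
      rcases hw with rfl | rfl
      · exact Or.inl hd
      · exact Or.inr hd
  choose! H hH0 hHB hHA using hel
  refine ⟨Good.image (fun p => p * H p), ?_, ?_⟩
  · intro n hn
    obtain ⟨p, hp, rfl⟩ := Finset.mem_image.1 hn
    refine ⟨hHA p hp, ?_⟩
    rw [mul_comm]
    exact Nat.mul_le_mul (hHB p hp) (hwin p hp).2.2
  · rw [Finset.card_image_of_injOn]
    · exact hGood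
    · intro p hp p' hp' heq
      by_contra hne
      obtain ⟨a, b, c⟩ := hwin p hp
      obtain ⟨a', b', c'⟩ := hwin p' hp'
      have h1 : p ∣ p' * H p' := by
        have : p * H p = p' * H p' := heq
        rw [← this]; exact dvd_mul_right _ _
      rcases a.dvd_mul.1 h1 with h2 | h2
      · exact hne ((Nat.prime_dvd_prime_iff_eq a a').1 h2)
      · have := Nat.le_of_dvd (hH0 p' hp') h2
        have := hHB p' hp'
        omega

theorem stmt13 :
    ∃ c : ℝ, 0 < c ∧ ∀ x : ℝ, 2 ≤ x →
      c * (x / Real.log x) ≤ (Nat.card {n : ℕ | n ∈ Afib ∧ (n : ℝ) ≤ x} : ℝ) := by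
  obtain ⟨B, X1, hB, hmain⟩ := main_count
  have hBr : (0 : ℝ) < B := by exact_mod_cast hB
  have hfin : ∀ x : ℝ, {n : ℕ | n ∈ Afib ∧ (n : ℝ) ≤ x}.Finite := by
    intro x
    apply (Set.finite_Iic ⌊x⌋₊).subset
    intro n hn
    exact Nat.le_floor hn.2
  have hl2 : 0 < Real.log 2 := Real.log_pos (by norm_num)
  set Y : ℝ := B * (X1 + 2) with hY
  have hYpos : 0 < Y := by positivity
  refine ⟨min (1 / (10 * B)) (Real.log 2 / Y), by positivity, fun x hx => ?_⟩
  have hlx : Real.log 2 ≤ Real.log x := Real.log_le_log (by norm_num) hx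
  have hlx0 : 0 < Real.log x := by linarith
  have hq0 : 0 ≤ x / Real.log x := by positivity
  rcases le_total Y x with h | h
  · have hxB : (X1 : ℝ) + 2 ≤ x / B := by
      rw [le_div_iff₀ hBr]; linarith [mul_comm (B : ℝ) (X1 + 2)]
    set X := ⌊x / B⌋₊ with hX
    have hX1X : X1 ≤ X := Nat.le_floor (by linarith)
    have hX2 : 2 ≤ X := Nat.le_floor (by
      have : (0 : ℝ) ≤ X1 := by positivity
      push_cast; linarith)
    have hX2r : (2 : ℝ) ≤ X := by exact_mod_cast hX2
    have hXle : (X : ℝ) ≤ x / B := Nat.floor_le (by positivity)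
    have hXlt : x / B < X + 1 := Nat.lt_floor_add_one _
    obtain ⟨G, hG, hGc⟩ := hmain X hX1X
    have hBX : (B : ℝ) * X ≤ x := by rw [le_div_iff₀ hBr] at hXle; linarith
    have hB1 : (1 : ℝ) ≤ B := by exact_mod_cast hB
    have hsub : (G : Set ℕ) ⊆ {n : ℕ | n ∈ Afib ∧ (n : ℝ) ≤ x} := by
      intro n hn
      obtain ⟨h1, h2⟩ := hG n hn
      have : (n : ℝ) ≤ B * X := by exact_mod_cast h2
      exact ⟨h1, by linarith⟩
    have hcard : (G.card : ℝ) ≤ Nat.card {n : ℕ | n ∈ Afib ∧ (n : ℝ) ≤ x} := by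
      have := Nat.card_mono (hfin x) hsub
      rw [Nat.card_coe_set_eq, Set.ncard_coe_finset] at this
      exact_mod_cast this
    refine le_trans ?_ hcard
    have hlogle : Real.log X ≤ Real.log x := Real.log_le_log (by linarith) (by nlinarith)
    have h3 : (X : ℝ) / 5 ≤ G.card * Real.log x := hGc.trans (by gcongr)
    calc min (1 / (10 * (B : ℝ))) (Real.log 2 / Y) * (x / Real.log x)
        ≤ 1 / (10 * (B : ℝ)) * (x / Real.log x) := by gcongr; exact min_le_left _ _
      _ = (x / B / 10) / Real.log x := by field_simp
      _ ≤ G.card := by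
          rw [div_le_iff₀ hlx0]
          linarith
  · have h1 : (1 : ℝ) ≤ Nat.card {n : ℕ | n ∈ Afib ∧ (n : ℝ) ≤ x} := by
      have hsub : ({1} : Set ℕ) ⊆ {n : ℕ | n ∈ Afib ∧ (n : ℝ) ≤ x} := by
        rintro n rfl
        exact ⟨⟨1, by norm_num, by decide⟩, by push_cast; linarith⟩
      have := Nat.card_mono (hfin x) hsub
      rw [Nat.card_coe_set_eq, Set.ncard_singleton] at this
      exact_mod_cast this
    refine le_trans ?_ h1
    calc min (1 / (10 * (B : ℝ))) (Real.log 2 / Y) * (x / Real.log x)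
        ≤ Real.log 2 / Y * (x / Real.log x) := by gcongr; exact min_le_right _ _
      _ ≤ Real.log 2 / Y * (Y / Real.log 2) := by gcongr
      _ = 1 := by field_simp
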